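/- Let n = 3 and let b be the cyclic system of rank 3 with b 0 and b 1 given by b i r r' = 1/8 if r = r' and 3/8 if r ≠ r', and with third bunch b 2 given by b 2 false false = 1/8, b 2 false true = 3/8, b 2 true false = 7/16, b 2 true true = 1/16 (where the first argument is the value of R_3^3 and the second the value of R_1^3). This system is inconsistently connected, and CNT3(b) = 1/8 and CNTF(b) = 1/4, so that CNTF(b) = (3 − 1) · CNT3(b). -/

import Mathlib

open Finset

/-- Cyclic predecessor `i ⊖ 1` on `Fin n`. -/
def fpred {n : ℕ} (i : Fin n) : Fin n := ⟨(i.val + (n - 1)) % n, Nat.mod_lt _ i.pos⟩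

/-- Cyclic successor `i ⊕ 1` on `Fin n`. -/
def fsucc {n : ℕ} (i : Fin n) : Fin n := ⟨(i.val + 1) % n, Nat.mod_lt _ i.pos⟩

/-- `b` specifies a cyclic system of rank `n`: each bunch distribution is
nonnegative and sums to one. -/
def IsCyclicSystem (n : ℕ) (b : Fin n → Bool → Bool → ℝ) : Prop :=
  (∀ i r r', 0 ≤ b i r r') ∧ ∀ i, (∑ r : Bool, ∑ r' : Bool, b i r r') = 1

/-- Marginal distribution of `R_i^i`. -/
def mFst {n : ℕ} (b : Fin n → Bool → Bool → ℝ) (i : Fin n) (r : Bool) : ℝ :=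
  b i r false + b i r true

/-- Marginal distribution of `R_i^{i⊖1}`. -/
def mSnd {n : ℕ} (b : Fin n → Bool → Bool → ℝ) (i : Fin n) (r : Bool) : ℝ :=
  b (fpred i) false r + b (fpred i) true r

/-- Multimaximal-coupling distribution of connection `i`:
joint distribution of `(T_i^i, T_i^{i⊖1})`. -/
noncomputable def mmc {n : ℕ} (b : Fin n → Bool → Bool → ℝ) (i : Fin n) : Bool → Bool → ℝ :=
  fun r r' =>
    match r, r' with
    | true, true => min (mFst b i true) (mSnd b i true)
    | false, false => min (mFst b i false) (mSnd b i false)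
    | true, false => mFst b i true - min (mFst b i true) (mSnd b i true)
    | false, true => mSnd b i true - min (mFst b i true) (mSnd b i true)

/-- Bunch marginal of a signed quasi-coupling `y` at context `i`. -/
def Bm {n : ℕ} (i : Fin n) (y : (Fin n → Bool × Bool) → ℝ) (r r' : Bool) : ℝ :=
  ∑ s : Fin n → Bool × Bool, if s i = (r, r') then y s else 0

/-- Connection marginal of a signed quasi-coupling `y` at content `i`. -/
def Cm {n : ℕ} (i : Fin n) (y : (Fin n → Bool × Bool) → ℝ) (r r' : Bool) : ℝ :=
  ∑ s : Fin n → Bool × Bool, if (s i).1 = r ∧ (s (fpred i)).2 = r' then y s else 0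

/-- `y` is a feasible signed quasi-coupling for the system `b`. -/
def Feasible {n : ℕ} (b : Fin n → Bool → Bool → ℝ) (y : (Fin n → Bool × Bool) → ℝ) : Prop :=
  ∀ i r r', Bm i y r r' = b i r r' ∧ Cm i y r r' = mmc b i r r'

/-- The quasi-coupling measure of contextuality. -/
noncomputable def CNT3 {n : ℕ} (b : Fin n → Bool → Bool → ℝ) : ℝ :=
  sInf {t : ℝ | ∃ y, Feasible b y ∧ t = ∑ s : Fin n → Bool × Bool, |y s|} - 1

/-- Constraints of the contextual-fraction linear program. -/
def CNTFConstraints {n : ℕ} (b : Fin n → Bool → Bool → ℝ)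
    (z : (Fin n → Bool × Bool) → ℝ) : Prop :=
  (∀ s, 0 ≤ z s) ∧ ∀ i r r', Bm i z r r' ≤ b i r r' ∧ Cm i z r r' ≤ mmc b i r r'

/-- The contextual fraction. -/
noncomputable def CNTF {n : ℕ} (b : Fin n → Bool → Bool → ℝ) : ℝ :=
  1 - sSup {t : ℝ | ∃ z, CNTFConstraints b z ∧ t = ∑ s : Fin n → Bool × Bool, z s}

/-- `b` is noncontextual iff it admits a nonnegative feasible coupling. -/
def Noncontextual {n : ℕ} (b : Fin n → Bool → Bool → ℝ) : Prop :=
  ∃ y, Feasible b y ∧ ∀ s, 0 ≤ y s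

/-- The inconsistently connected rank-3 cyclic system of Example 2: the first two bunches
have `Pr(0,0) = Pr(1,1) = 1/8`, `Pr(0,1) = Pr(1,0) = 3/8`, and the third bunch has
`Pr(0,0) = 1/8`, `Pr(0,1) = 3/8`, `Pr(1,0) = 7/16`, `Pr(1,1) = 1/16`. -/
noncomputable def bEx' : Fin 3 → Bool → Bool → ℝ :=
  fun i r r' =>
    if i.val = 2 then
      match r, r' with
      | false, false => 1/8
      | false, true => 3/8
      | true, false => 7/16
      | true, true => 1/16
    else if r = r' then 1/8 else 3/8

/-- The number of violated relations in the joint state `s`, where the relations ask for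
unequal values inside every bunch and equal values inside every connection. -/
def violations {n : ℕ} (s : Fin n → Bool × Bool) : ℕ :=
  ∑ i, ((if (s i).1 = (s i).2 then 1 else 0) + if (s i).1 = (s (fpred i)).2 then 0 else 1)

theorem one_le_violations_le_five (s : Fin 3 → Bool × Bool) :
    1 ≤ violations s ∧ violations s ≤ 5 := by
  have key : ∀ p q r : Bool × Bool,
      1 ≤ violations ![p, q, r] ∧ violations ![p, q, r] ≤ 5 := by decide
  have hs : s = ![s 0, s 1, s 2] := by
    ext i <;> fin_cases i <;> rfl
  rw [hs]
  exact key _ _ _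

theorem sum_violations_mul {n : ℕ} (y : (Fin n → Bool × Bool) → ℝ) :
    ∑ s, (violations s : ℝ) * y s =
      ∑ i, (Bm i y true true + Bm i y false false + (Cm i y true false + Cm i y false true)) := by
  simp only [Bm, Cm, ← Finset.sum_add_distrib]
  rw [Finset.sum_comm]
  refine Finset.sum_congr rfl fun s _ => ?_
  simp only [violations, Nat.cast_sum, Finset.sum_mul]
  refine Finset.sum_congr rfl fun i _ => ?_
  rcases h : s i with ⟨a, c⟩
  cases a <;> cases c <;> cases (s (fpred i)).2 <;> simp <;> ring

theorem sum_eq_sum_Bm {n : ℕ} (i : Fin n) (y : (Fin n → Bool × Bool) → ℝ) :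
    ∑ s, y s = ∑ r : Bool, ∑ r' : Bool, Bm i y r r' := by
  simp only [Bm, Fintype.sum_bool, ← Finset.sum_add_distrib]
  refine Finset.sum_congr rfl fun s _ => ?_
  rcases h : s i with ⟨a, c⟩
  cases a <;> cases c <;> simp

theorem bEx'_isCyclicSystem : IsCyclicSystem 3 bEx' := by
  constructor
  · intro i r r'
    fin_cases i <;> cases r <;> cases r' <;> norm_num [bEx']
  · intro i
    fin_cases i <;> norm_num [bEx']

/-- The masses of the violations under the bunch distributions of `bEx'` and their multimaximal
couplings sum to `3 / 4`. -/
theorem sum_bEx'_violations :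
    ∑ i, (bEx' i true true + bEx' i false false +
      (mmc bEx' i true false + mmc bEx' i false true)) = 3 / 4 := by
  norm_num [Fin.sum_univ_three, mmc, mFst, mSnd, bEx', fpred]

theorem sum_le_of_CNTFConstraints {z : (Fin 3 → Bool × Bool) → ℝ}
    (hz : CNTFConstraints bEx' z) : ∑ s, z s ≤ 3 / 4 := by
  calc ∑ s, z s ≤ ∑ s, (violations s : ℝ) * z s := by
        refine Finset.sum_le_sum fun s _ => le_mul_of_one_le_left (hz.1 s) ?_
        exact_mod_cast (one_le_violations_le_five s).1
    _ ≤ 3 / 4 := by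
        rw [sum_violations_mul, ← sum_bEx'_violations]
        gcongr
        exacts [(hz.2 _ _ _).1, (hz.2 _ _ _).1, (hz.2 _ _ _).2, (hz.2 _ _ _).2]

theorem le_sum_abs_of_feasible {y : (Fin 3 → Bool × Bool) → ℝ}
    (hy : Feasible bEx' y) : 9 / 8 ≤ ∑ s, |y s| := by
  have hsum : ∑ s, y s = 1 := by
    rw [sum_eq_sum_Bm 0]
    simp only [(hy _ _ _).1]
    exact bEx'_isCyclicSystem.2 0
  have hviol : ∑ s, (violations s : ℝ) * y s = 3 / 4 := by
    rw [sum_violations_mul, ← sum_bEx'_violations]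
    simp only [(hy _ _ _).1, (hy _ _ _).2]
  calc (9 / 8 : ℝ) = ∑ s, (3 - (violations s : ℝ)) / 2 * y s := by
        have : ∀ s, (3 - (violations s : ℝ)) / 2 * y s =
            3 / 2 * y s - 1 / 2 * ((violations s : ℝ) * y s) := fun s => by ring
        simp only [this, Finset.sum_sub_distrib, ← Finset.mul_sum, hsum, hviol]
        norm_num
    _ ≤ ∑ s, |y s| := by
        refine Finset.sum_le_sum fun s _ => (le_abs_self _).trans ?_
        rw [abs_mul]
        refine mul_le_of_le_one_left (abs_nonneg _) (abs_le.2 ?_)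
        have h1 : (1 : ℝ) ≤ violations s := by exact_mod_cast (one_le_violations_le_five s).1
        have h5 : (violations s : ℝ) ≤ 5 := by exact_mod_cast (one_le_violations_le_five s).2
        constructor <;> linarith

/-- The signed measure with atoms of weight `w k` at `σ k`. -/
def atomic {S : Type*} [DecidableEq S] {m : ℕ} (σ : Fin m → S) (w : Fin m → ℝ) (s : S) : ℝ :=
  ∑ k, if s = σ k then w k else 0

theorem sum_ite_atomic {S : Type*} [Fintype S] [DecidableEq S] {m : ℕ} (σ : Fin m → S)
    (w : Fin m → ℝ) (P : S → Prop) [DecidablePred P] :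
    (∑ s, if P s then atomic σ w s else 0) = ∑ k, if P (σ k) then w k else 0 := by
  have h : ∀ s, (if P s then atomic σ w s else 0) =
      ∑ k, if s = σ k then (if P (σ k) then w k else 0) else 0 := fun s => by
    split_ifs with hs
    · exact Finset.sum_congr rfl fun k _ => by aesop
    · exact (Finset.sum_eq_zero fun k _ => by aesop).symm
  simp only [h]
  rw [Finset.sum_comm]
  simp

theorem sum_atomic {S : Type*} [Fintype S] [DecidableEq S] {m : ℕ} (σ : Fin m → S)
    (w : Fin m → ℝ) : ∑ s, atomic σ w s = ∑ k, w k := by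
  simpa using sum_ite_atomic σ w (fun _ => True)

theorem sum_abs_atomic_le {S : Type*} [Fintype S] [DecidableEq S] {m : ℕ} (σ : Fin m → S)
    (w : Fin m → ℝ) : ∑ s, |atomic σ w s| ≤ ∑ k, |w k| := by
  rw [← sum_atomic σ fun k => |w k|]
  refine Finset.sum_le_sum fun s _ => (Finset.abs_sum_le_sum_abs _ _).trans_eq ?_
  simp only [atomic, apply_ite abs, abs_zero]

theorem Bm_atomic {n m : ℕ} (σ : Fin m → Fin n → Bool × Bool) (w : Fin m → ℝ) (i : Fin n)
    (r r' : Bool) : Bm i (atomic σ w) r r' = ∑ k, if σ k i = (r, r') then w k else 0 :=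
  sum_ite_atomic σ w _

theorem Cm_atomic {n m : ℕ} (σ : Fin m → Fin n → Bool × Bool) (w : Fin m → ℝ) (i : Fin n)
    (r r' : Bool) : Cm i (atomic σ w) r r' =
      ∑ k, if (σ k i).1 = r ∧ (σ k (fpred i)).2 = r' then w k else 0 :=
  sum_ite_atomic σ w _

/-- The support of an optimal solution of the contextual-fraction linear program. -/
def packingStates : Fin 7 → Fin 3 → Bool × Bool :=
  ![![(false, false), (false, true), (true, false)],
    ![(true, true), (true, false), (false, true)],
    ![(true, false), (false, false), (false, true)],
    ![(false, true), (true, true), (true, false)],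
    ![(false, true), (true, false), (false, false)],
    ![(true, false), (false, true), (true, true)],
    ![(true, false), (false, true), (true, false)]]

/-- The weights of an optimal solution of the contextual-fraction linear program. -/
noncomputable def packingWeights : Fin 7 → ℝ :=
  ![1 / 8, 1 / 8, 1 / 8, 1 / 8, 1 / 8, 1 / 16, 1 / 16]

/-- The support of a signed quasi-coupling for `bEx'` of least total variation. -/
def quasiStates : Fin 13 → Fin 3 → Bool × Bool :=
  ![![(false, false), (false, true), (true, false)],
    ![(true, true), (true, false), (false, true)],
    ![(true, false), (false, false), (false, true)],
    ![(false, true), (true, true), (true, false)],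
    ![(false, true), (true, false), (false, false)],
    ![(true, false), (false, true), (true, true)],
    ![(true, false), (false, true), (true, false)],
    ![(false, true), (false, true), (true, false)],
    ![(true, false), (true, false), (false, true)],
    ![(true, false), (false, true), (false, true)],
    ![(false, true), (true, false), (true, false)],
    ![(false, false), (true, true), (false, false)],
    ![(true, true), (false, false), (true, true)]]

/-- The weights of a signed quasi-coupling for `bEx'` of least total variation. -/
noncomputable def quasiWeights : Fin 13 → ℝ :=
  ![5 / 32, 5 / 32, 5 / 32, 5 / 32, 5 / 32, 3 / 32, 2 / 32, 1 / 32, 1 / 32, 1 / 32, 1 / 32, -1 / 32, -1 / 32]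

theorem packing_constraints : CNTFConstraints bEx' (atomic packingStates packingWeights) := by
  constructor
  · intro s
    refine Finset.sum_nonneg fun k _ => ?_
    have : 0 ≤ packingWeights k := by fin_cases k <;> norm_num [packingWeights]
    split_ifs <;> simp [this]
  · intro i r r'
    rw [Bm_atomic, Cm_atomic]
    fin_cases i <;> cases r <;> cases r' <;>
      norm_num [Fin.sum_univ_succ, packingStates, packingWeights, mmc, mFst, mSnd, bEx', fpred]

theorem quasi_feasible : Feasible bEx' (atomic quasiStates quasiWeights) := by
  intro i r r'
  rw [Bm_atomic, Cm_atomic]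
  fin_cases i <;> cases r <;> cases r' <;>
    norm_num [Fin.sum_univ_succ, quasiStates, quasiWeights, mmc, mFst, mSnd, bEx', fpred]

theorem CNT3_bEx' : CNT3 bEx' = 1 / 8 := by
  have hle : ∑ s, |atomic quasiStates quasiWeights s| ≤ 9 / 8 :=
    (sum_abs_atomic_le _ _).trans_eq <| by
      norm_num [Fin.sum_univ_succ, quasiWeights, abs_of_pos, abs_of_neg]
  have hleast : IsLeast {t : ℝ | ∃ y, Feasible bEx' y ∧ t = ∑ s, |y s|} (9 / 8) := by
    refine ⟨⟨_, quasi_feasible, (le_sum_abs_of_feasible quasi_feasible).antisymm hle⟩, ?_⟩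
    rintro t ⟨y, hy, rfl⟩
    exact le_sum_abs_of_feasible hy
  rw [CNT3, hleast.csInf_eq]
  norm_num

theorem CNTF_bEx' : CNTF bEx' = 1 / 4 := by
  have hgreatest : IsGreatest {t : ℝ | ∃ z, CNTFConstraints bEx' z ∧ t = ∑ s, z s} (3 / 4) := by
    refine ⟨⟨_, packing_constraints, ?_⟩, ?_⟩
    · rw [sum_atomic]
      norm_num [Fin.sum_univ_succ, packingWeights]
    · rintro t ⟨z, hz, rfl⟩
      exact sum_le_of_CNTFConstraints hz
  rw [CNTF, hgreatest.csSup_eq]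
  norm_num

/-- The system `bEx'` is an inconsistently connected cyclic system of rank 3 with
`CNT3 = 1/8` and `CNTF = 1/4 = (3 - 1) · CNT3`. -/
theorem example_inconsistently_connected :
    IsCyclicSystem 3 bEx' ∧
    (∃ i, mFst bEx' i ≠ mSnd bEx' i) ∧
    CNT3 bEx' = 1/8 ∧ CNTF bEx' = 1/4 ∧
    CNTF bEx' = ((3 : ℝ) - 1) * CNT3 bEx' := by
  refine ⟨bEx'_isCyclicSystem, ⟨0, fun h => ?_⟩, CNT3_bEx', CNTF_bEx', ?_⟩
  · have := congrFun h true
    norm_num [mFst, mSnd, bEx', fpred] at this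
  · rw [CNT3_bEx', CNTF_bEx']
    norm_num
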